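/- Let U be a finite set, let s be a natural number, let D = {d_j^0, d_j^1 : 0 ≤ j ≤ s} be a set of 2(s+1) new elements disjoint from U, and let b_0, …, b_s ∈ {0,1}. Let F be a family of subsets of U and let F̂ be the family of subsets of U ∪ D consisting, for each A ∈ F, of the two sets A ∪ {d_j^{b_j} : 0 ≤ j ≤ s} and A ∪ {d_j^{1-b_j} : 0 ≤ j ≤ s}. Then for every X ⊆ U: the partition (X, U \ X) splits F if and only if the partition (X ∪ {d_j^{b_j} : 0 ≤ j ≤ s}, (U \ X) ∪ {d_j^{1-b_j} : 0 ≤ j ≤ s}) of U ∪ D splits F̂. -/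

import Mathlib

/-- A pair of disjoint parts `(W₀, W₁)` splits a family `F` of sets if every
member of `F` intersects both parts. -/
def SplitsFamily {α : Type*} (F : Set (Set α)) (W₀ W₁ : Set α) : Prop :=
  ∀ A ∈ F, (A ∩ W₀).Nonempty ∧ (A ∩ W₁).Nonempty

/-- Sets adjoined outside `U` and disjoint from each other do not create intersections. -/
theorem Set.Nonempty.inter_of_union_inter_union {α : Type*} {U A Y P Q : Set α}
    (hA : A ⊆ U) (hY : Y ⊆ U) (hP : Disjoint P U) (hQ : Disjoint Q U) (hPQ : Disjoint P Q)
    (h : ((A ∪ P) ∩ (Y ∪ Q)).Nonempty) : (A ∩ Y).Nonempty := by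
  obtain ⟨x, hxA | hxP, hxY | hxQ⟩ := h
  · exact ⟨x, hxA, hxY⟩
  · exact (Set.disjoint_left.mp hQ hxQ (hA hxA)).elim
  · exact (Set.disjoint_left.mp hP hxP (hY hxY)).elim
  · exact (Set.disjoint_left.mp hPQ hxP hxQ).elim

/-- splitting is preserved by the augmentation of a family by the
instance-selection elements `d j (b j)` and `d j (!b j)`.  Here `d j c` plays the
role of `d_j^c` for `0 ≤ j ≤ s`, a set of `2(s+1)` new elements disjoint from `U`. -/
theorem splits_augmented_family_iff {α : Type*} (s : ℕ) (U : Set α)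
    (d : Fin (s + 1) → Bool → α)
    (hd : Function.Injective (fun jc : Fin (s + 1) × Bool => d jc.1 jc.2))
    (hdU : ∀ j c, d j c ∉ U)
    (b : Fin (s + 1) → Bool)
    (F : Set (Set α)) (hF : ∀ A ∈ F, A ⊆ U)
    (Fhat : Set (Set α))
    (hFhat : Fhat = {B | ∃ A ∈ F,
      B = A ∪ Set.range (fun j => d j (b j)) ∨
      B = A ∪ Set.range (fun j => d j (!b j))}) :
    ∀ X ⊆ U,
      (SplitsFamily F X (U \ X) ↔
        SplitsFamily Fhat (X ∪ Set.range (fun j => d j (b j)))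
          ((U \ X) ∪ Set.range (fun j => d j (!b j)))) := by
  intro X hX
  subst hFhat
  have hU : ∀ c : Fin (s + 1) → Bool, Disjoint (Set.range fun j => d j (c j)) U := by
    intro c
    rw [Set.disjoint_left]
    rintro _ ⟨j, rfl⟩
    exact hdU j (c j)
  have hb : Disjoint (Set.range fun j => d j (b j)) (Set.range fun j => d j (!b j)) := by
    rw [Set.disjoint_left]
    rintro _ ⟨j, rfl⟩ ⟨k, hk⟩
    obtain ⟨rfl, h⟩ := Prod.mk.inj (@hd (k, !b k) (j, b j) hk)
    simp at h
  constructor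
  · rintro h B ⟨A, hA, rfl | rfl⟩ <;> obtain ⟨h₀, h₁⟩ := h A hA <;>
      exact ⟨h₀.mono (Set.inter_subset_inter Set.subset_union_left Set.subset_union_left),
        h₁.mono (Set.inter_subset_inter Set.subset_union_left Set.subset_union_left)⟩
  · intro h A hA
    exact ⟨(h _ ⟨A, hA, Or.inr rfl⟩).1.inter_of_union_inter_union (hF A hA) hX
        (hU fun j => !b j) (hU b) hb.symm,
      (h _ ⟨A, hA, Or.inl rfl⟩).2.inter_of_union_inter_union (hF A hA) Set.sdiff_subset
        (hU b) (hU fun j => !b j) hb⟩
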